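/- Assume the Goldberg–Seymour statement: every multigraph H with χ'(H) ≥ Δ(H)+2 satisfies χ'(H) = ⌈ρ(H)⌉. If G is a multigraph with χ'(G) = k ≥ max{Δ(G)+2, |V(G)|+1}, then there exists a multigraph G' containing G as a subgraph such that |V(G')| is odd, |V(G')| ≥ 3, 2|E(G')| = k(|V(G')|−1), χ'(G') = k, and Δ(G') ≤ k−1. -/

import Mathlib

/-- A multigraph: a finite graph possibly with parallel edges but no loops.
Edges are abstract objects, each mapped to an unordered pair of distinct vertices. -/
structure Multigraph where
  V : Type
  E : Type
  fintypeV : Fintype V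
  fintypeE : Fintype E
  decEqV : DecidableEq V
  decEqE : DecidableEq E
  ends : E → Sym2 V
  loopless : ∀ e, ¬ (ends e).IsDiag

attribute [instance] Multigraph.fintypeV Multigraph.fintypeE
attribute [instance] Multigraph.decEqV Multigraph.decEqE

namespace Multigraph

variable (G : Multigraph)

/-- The degree of a vertex: the number of edges incident with it. -/
def degree (v : G.V) : ℕ :=
  (Finset.univ.filter fun e : G.E => v ∈ G.ends e).card

/-- The maximum degree Δ(G). -/
def maxDegree : ℕ :=
  Finset.univ.sup G.degree

/-- A proper edge coloring with color set `Fin k`: edges sharing an endpoint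
receive distinct colors. -/
def IsProperEdgeColoring {k : ℕ} (φ : G.E → Fin k) : Prop :=
  ∀ e f : G.E, e ≠ f → (∃ v, v ∈ G.ends e ∧ v ∈ G.ends f) → φ e ≠ φ f

/-- The chromatic index χ'(G): the least `k` admitting a proper edge `k`-coloring. -/
noncomputable def chromaticIndex : ℕ :=
  sInf {k | ∃ φ : G.E → Fin k, G.IsProperEdgeColoring φ}

/-- Two vertices are adjacent if some edge joins them. -/
def Adj (u v : G.V) : Prop := ∃ e, G.ends e = s(u, v)

/-- A proper total coloring with color set `Fin k`: no two adjacent or incident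
elements of `V(G) ∪ E(G)` receive the same color. -/
def IsProperTotalColoring {k : ℕ} (cV : G.V → Fin k) (cE : G.E → Fin k) : Prop :=
  G.IsProperEdgeColoring cE ∧
  (∀ u v : G.V, G.Adj u v → cV u ≠ cV v) ∧
  (∀ v e, v ∈ G.ends e → cV v ≠ cE e)

/-- The total chromatic number χ''(G): the least `k` admitting a proper total
`k`-coloring. -/
noncomputable def totalChromaticNumber : ℕ :=
  sInf {k | ∃ (cV : G.V → Fin k) (cE : G.E → Fin k), G.IsProperTotalColoring cV cE}

/-- `H` is a subgraph of `G`: there are injections of the vertices and edges of `H`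
into those of `G` preserving the incidence structure. -/
def IsSubgraph (H G : Multigraph) : Prop :=
  ∃ (f : H.V → G.V) (g : H.E → G.E),
    Function.Injective f ∧ Function.Injective g ∧
    ∀ e, G.ends (g e) = (H.ends e).map f

/-- `H` is a spanning subgraph of `G`: a subgraph whose vertex set is all of `V(G)`. -/
def IsSpanningSubgraph (H G : Multigraph) : Prop :=
  ∃ (f : H.V → G.V) (g : H.E → G.E),
    Function.Bijective f ∧ Function.Injective g ∧
    ∀ e, G.ends (g e) = (H.ends e).map f

/-- `H` is a proper subgraph of `G`. -/
def IsProperSubgraph (H G : Multigraph) : Prop :=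
  IsSubgraph H G ∧ ¬ IsSubgraph G H

/-- `G` is edge-chromatic critical: every proper subgraph has a smaller chromatic index. -/
def EdgeChromaticCritical (G : Multigraph) : Prop :=
  ∀ H : Multigraph, IsProperSubgraph H G → H.chromaticIndex < G.chromaticIndex

/-- The density ρ(G) = max{2|E(H)|/(|V(H)|−1) : H ⊆ G, |V(H)| ≥ 3 odd}
(0 if no such subgraph exists). -/
noncomputable def density (G : Multigraph) : ℝ :=
  sSup ({0} ∪ {q : ℝ | ∃ H : Multigraph, IsSubgraph H G ∧ Odd (Fintype.card H.V) ∧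
    3 ≤ Fintype.card H.V ∧
    q = 2 * (Fintype.card H.E : ℝ) / ((Fintype.card H.V : ℝ) - 1)})

/-- A subgraph of `G` given by a set of vertices and a set of edges of `G`
whose endpoints all lie in the chosen vertex set. -/
structure Sub (G : Multigraph) where
  verts : Finset G.V
  edges : Finset G.E
  support : ∀ e ∈ edges, ∀ v, v ∈ G.ends e → v ∈ verts

/-- A subgraph is `k`-dense if its order is odd and at least 3, and
`2|E(H)| = k(|V(H)|−1)`. -/
def Sub.IsDense {G : Multigraph} (S : G.Sub) (k : ℕ) : Prop :=
  Odd S.verts.card ∧ 3 ≤ S.verts.card ∧ 2 * S.edges.card = k * (S.verts.card - 1)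

/-- A subgraph is maximal `k`-dense if it is `k`-dense and no `k`-dense subgraph
contains it as a proper subgraph. -/
def Sub.MaximalDense {G : Multigraph} (S : G.Sub) (k : ℕ) : Prop :=
  S.IsDense k ∧ ∀ T : G.Sub, T.IsDense k → S.verts ⊆ T.verts → S.edges ⊆ T.edges →
    S.verts = T.verts ∧ S.edges = T.edges

/-- The set of colors of `Fin k` missing at `v` under the edge coloring `φ`. -/
def missing {k : ℕ} (φ : G.E → Fin k) (v : G.V) : Set (Fin k) :=
  {c | ∀ e : G.E, v ∈ G.ends e → φ e ≠ c}

/-- A vertex set `W` is elementary under `φ` if the sets of missing colors of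
distinct vertices of `W` are disjoint. -/
def Elementary {k : ℕ} (φ : G.E → Fin k) (W : Set G.V) : Prop :=
  ∀ u ∈ W, ∀ v ∈ W, u ≠ v → Disjoint (G.missing φ u) (G.missing φ v)

/-- An edge is a boundary edge of `W` if exactly one of its ends lies in `W`. -/
def IsBoundaryEdge (W : Set G.V) (e : G.E) : Prop :=
  ∃ a b, G.ends e = s(a, b) ∧ a ∈ W ∧ b ∉ W

/-- Deleting an edge from a multigraph. -/
def deleteEdge (G : Multigraph) (e : G.E) : Multigraph where
  V := G.V
  E := {f : G.E // f ≠ e}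
  fintypeV := G.fintypeV
  fintypeE := by classical exact inferInstance
  decEqV := G.decEqV
  decEqE := by classical exact inferInstance
  ends := fun f => G.ends f.1
  loopless := fun f => G.loopless f.1

/-- Adding a new edge joining two distinct vertices of a multigraph. -/
def addEdge (G : Multigraph) (u v : G.V) (huv : u ≠ v) : Multigraph where
  V := G.V
  E := Option G.E
  fintypeV := G.fintypeV
  fintypeE := inferInstance
  decEqV := G.decEqV
  decEqE := inferInstance
  ends := fun e => e.elim s(u, v) G.ends
  loopless := fun e => by
    cases e with
    | none => simpa using huv
    | some f => exact G.loopless f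

end Multigraph

open Multigraph

namespace Multigraph

theorem IsSubgraph.refl (G : Multigraph) : IsSubgraph G G :=
  ⟨id, id, Function.injective_id, Function.injective_id, fun e => by simp⟩

theorem IsSubgraph.trans {G H K : Multigraph} (h₁ : IsSubgraph G H) (h₂ : IsSubgraph H K) :
    IsSubgraph G K := by
  obtain ⟨f, g, hf, hg, h⟩ := h₁
  obtain ⟨f', g', hf', hg', h'⟩ := h₂
  refine ⟨f' ∘ f, g' ∘ g, hf'.comp hf, hg'.comp hg, fun e => ?_⟩
  simp [h', h, Sym2.map_map]

theorem isSubgraph_addEdge (G : Multigraph) (u v : G.V) (huv : u ≠ v) :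
    IsSubgraph G (G.addEdge u v huv) :=
  ⟨id, some, Function.injective_id, Option.some_injective _, fun e => by simp [addEdge]⟩

/-- Adding an isolated vertex. -/
def addVertex (G : Multigraph) : Multigraph where
  V := Option G.V
  E := G.E
  fintypeV := inferInstance
  fintypeE := inferInstance
  decEqV := inferInstance
  decEqE := inferInstance
  ends := fun e => (G.ends e).map some
  loopless := fun e => by
    rw [Sym2.isDiag_map (Option.some_injective _)]
    exact G.loopless e

/-- Adding an apex vertex joined by a single edge to every vertex. -/
def cone (G : Multigraph) : Multigraph where
  V := Option G.V
  E := G.E ⊕ G.V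
  fintypeV := inferInstance
  fintypeE := inferInstance
  decEqV := inferInstance
  decEqE := inferInstance
  ends := Sum.elim (fun e => (G.ends e).map some) (fun v => s(none, some v))
  loopless := by
    rintro (e | v)
    · simpa [Sym2.isDiag_map (Option.some_injective _)] using G.loopless e
    · simp

theorem isSubgraph_addVertex (G : Multigraph) : IsSubgraph G G.addVertex :=
  ⟨some, id, Option.some_injective _, Function.injective_id, fun _ => rfl⟩

theorem card_ends (G : Multigraph) (e : G.E) :
    (Finset.univ.filter fun v => v ∈ G.ends e).card = 2 := by
  rw [← Sym2.card_toFinset_of_not_isDiag _ (G.loopless e)]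
  congr 1
  ext v
  simp

theorem sum_card_incident (G : Multigraph) (S : Finset G.E) :
    ∑ v, (S.filter fun e => v ∈ G.ends e).card = 2 * S.card := by
  have h := Finset.sum_card_bipartiteAbove_eq_sum_card_bipartiteBelow
    (s := (Finset.univ : Finset G.V)) (t := S) (fun v e => v ∈ G.ends e)
  simp only [Finset.bipartiteAbove, Finset.bipartiteBelow, card_ends, Finset.sum_const,
    smul_eq_mul] at h
  rw [h, mul_comm]

theorem sum_degree (G : Multigraph) : ∑ v, G.degree v = 2 * Fintype.card G.E :=
  G.sum_card_incident Finset.univ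

theorem degree_le_maxDegree (G : Multigraph) (v : G.V) : G.degree v ≤ G.maxDegree :=
  Finset.le_sup (f := G.degree) (Finset.mem_univ v)

theorem degree_le_of_isSubgraph {H G : Multigraph} {f : H.V → G.V} {g : H.E → G.E}
    (hg : Function.Injective g) (h : ∀ e, G.ends (g e) = (H.ends e).map f) (v : H.V) :
    H.degree v ≤ G.degree (f v) := by
  refine Finset.card_le_card_of_injOn g (fun e he => ?_) hg.injOn
  simp only [Finset.coe_filter, Finset.mem_univ, true_and, Set.mem_ofPred_eq] at he ⊢
  rw [h]
  exact Sym2.mem_map.2 ⟨v, he, rfl⟩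

theorem exists_isProperEdgeColoring (G : Multigraph) :
    ∃ φ : G.E → Fin G.chromaticIndex, G.IsProperEdgeColoring φ :=
  Nat.sInf_mem (s := {k | ∃ φ : G.E → Fin k, G.IsProperEdgeColoring φ})
    ⟨Fintype.card G.E, Fintype.equivFin G.E, fun _ _ hef _ h =>
      hef ((Fintype.equivFin G.E).injective h)⟩

theorem exists_isProperEdgeColoring_of_le {G : Multigraph} {k : ℕ} (h : G.chromaticIndex ≤ k) :
    ∃ φ : G.E → Fin k, G.IsProperEdgeColoring φ := by
  obtain ⟨φ, hφ⟩ := G.exists_isProperEdgeColoring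
  exact ⟨fun e => Fin.castLE h (φ e), fun e f hef hv heq =>
    hφ e f hef hv (Fin.castLE_injective h heq)⟩

theorem IsProperEdgeColoring.chromaticIndex_le {G : Multigraph} {k : ℕ} {φ : G.E → Fin k}
    (h : G.IsProperEdgeColoring φ) : G.chromaticIndex ≤ k :=
  Nat.sInf_le ⟨φ, h⟩

theorem IsSubgraph.chromaticIndex_le {H G : Multigraph} (h : IsSubgraph H G) :
    H.chromaticIndex ≤ G.chromaticIndex := by
  obtain ⟨f, g, -, hg, hfg⟩ := h
  obtain ⟨φ, hφ⟩ := G.exists_isProperEdgeColoring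
  refine IsProperEdgeColoring.chromaticIndex_le (φ := φ ∘ g) fun e e' hne ⟨v, hv, hv'⟩ => ?_
  refine hφ _ _ (hg.ne hne) ⟨f v, ?_, ?_⟩ <;> rw [hfg] <;> exact Sym2.mem_map.2 ⟨v, ‹_›, rfl⟩

/-- The edges of a color class cover exactly the vertices not missing the color. -/
theorem IsProperEdgeColoring.two_mul_card_add_card_missing {G : Multigraph} {k : ℕ}
    {φ : G.E → Fin k} (h : G.IsProperEdgeColoring φ) (c : Fin k) [DecidablePred (c ∈ G.missing φ ·)] :
    2 * (Finset.univ.filter fun e => φ e = c).card +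
      (Finset.univ.filter fun v => c ∈ G.missing φ v).card = Fintype.card G.V := by
  rw [← sum_card_incident, Finset.card_filter (fun v => c ∈ G.missing φ v),
    ← Finset.sum_add_distrib, Fintype.card_eq_sum_ones]
  refine Finset.sum_congr rfl fun v _ => ?_
  rw [Finset.filter_filter]
  split_ifs with hc
  · rw [Finset.card_eq_zero.2, zero_add]
    exact Finset.filter_eq_empty_iff.2 fun e _ he => hc e he.2 he.1
  · simp only [missing, Set.mem_ofPred_eq, not_forall, not_not] at hc
    obtain ⟨e, hve, hec⟩ := hc
    rw [add_zero, Finset.card_eq_one]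
    refine ⟨e, Finset.ext fun f => ?_⟩
    simp only [Finset.mem_filter, Finset.mem_univ, true_and, Finset.mem_singleton]
    constructor
    · rintro ⟨hfc, hvf⟩
      by_contra hne
      exact h f e hne ⟨v, hvf, hve⟩ (hfc.trans hec.symm)
    · rintro rfl
      exact ⟨hec, hve⟩

theorem IsProperEdgeColoring.two_mul_card_le {G : Multigraph} {k : ℕ} {φ : G.E → Fin k}
    (h : G.IsProperEdgeColoring φ) : 2 * Fintype.card G.E ≤ k * Fintype.card G.V := by
  classical
  have hE : Fintype.card G.E = ∑ c : Fin k, (Finset.univ.filter fun e => φ e = c).card :=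
    Finset.card_eq_sum_card_fiberwise (fun _ _ => Finset.mem_univ _)
  rw [hE, Finset.mul_sum]
  calc _ ≤ ∑ c : Fin k, Fintype.card G.V :=
        Finset.sum_le_sum fun c _ => by have := h.two_mul_card_add_card_missing c; omega
    _ = _ := by simp

/-- In a graph of odd order that is not `k`-dense, some color is missing at three vertices. -/
theorem IsProperEdgeColoring.exists_two_lt_card_missing {G : Multigraph} {k : ℕ}
    {φ : G.E → Fin k} (h : G.IsProperEdgeColoring φ) (hodd : Odd (Fintype.card G.V))
    (hne : 2 * Fintype.card G.E ≠ k * (Fintype.card G.V - 1))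
    [∀ c, DecidablePred (c ∈ G.missing φ ·)] :
    ∃ c, 2 < (Finset.univ.filter fun v => c ∈ G.missing φ v).card := by
  by_contra! hall
  refine hne ?_
  have hE : Fintype.card G.E = ∑ c : Fin k, (Finset.univ.filter fun e => φ e = c).card :=
    Finset.card_eq_sum_card_fiberwise (fun _ _ => Finset.mem_univ _)
  rw [hE, Finset.mul_sum]
  obtain ⟨m, hm⟩ := hodd
  calc _ = ∑ c : Fin k, (Fintype.card G.V - 1) := Finset.sum_congr rfl fun c _ => by
        have := h.two_mul_card_add_card_missing c
        have := hall c
        omega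
    _ = _ := by simp

theorem IsProperEdgeColoring.addEdge {G : Multigraph} {k : ℕ} {φ : G.E → Fin k}
    (h : G.IsProperEdgeColoring φ) {u v : G.V} (huv : u ≠ v) {c : Fin k}
    (hu : c ∈ G.missing φ u) (hv : c ∈ G.missing φ v) :
    (G.addEdge u v huv).IsProperEdgeColoring (fun e : Option G.E => e.elim c φ) := by
  have key : ∀ e : G.E, (∃ x, x ∈ s(u, v) ∧ x ∈ G.ends e) → φ e ≠ c := by
    rintro e ⟨x, hx, hxe⟩
    rcases Sym2.mem_iff.1 hx with rfl | rfl
    · exact hu e hxe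
    · exact hv e hxe
  rintro (_ | e) (_ | f) hne ⟨x, hx, hx'⟩
  · exact absurd rfl hne
  · exact (key f ⟨x, hx, hx'⟩).symm
  · exact key e ⟨x, hx', hx⟩
  · exact h e f (fun h => hne (congrArg some h)) ⟨x, hx, hx'⟩

/-- A coloring of a graph of odd order whose vertices miss pairwise distinct colors extends to
a coloring of a `k`-dense graph on the same vertices, all still missing a color. -/
theorem IsProperEdgeColoring.exists_dense_extension {G : Multigraph} {k : ℕ} {φ : G.E → Fin k}
    (h : G.IsProperEdgeColoring φ) (hodd : Odd (Fintype.card G.V)) {r : G.V → Fin k}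
    (hr : Function.Injective r) (hmiss : ∀ v, r v ∈ G.missing φ v) :
    ∃ G' : Multigraph, IsSubgraph G G' ∧ Fintype.card G'.V = Fintype.card G.V ∧
      2 * Fintype.card G'.E = k * (Fintype.card G'.V - 1) ∧
      ∃ (φ' : G'.E → Fin k) (r' : G'.V → Fin k), G'.IsProperEdgeColoring φ' ∧
        ∀ v, r' v ∈ G'.missing φ' v := by
  classical
  obtain ⟨d, hd⟩ : ∃ d, k * Fintype.card G.V - Fintype.card G.E = d := ⟨_, rfl⟩
  induction d using Nat.strong_induction_on generalizing G with
  | _ d ih =>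
  by_cases hdense : 2 * Fintype.card G.E = k * (Fintype.card G.V - 1)
  · exact ⟨G, .refl G, rfl, hdense, φ, r, h, hmiss⟩
  obtain ⟨c, hc⟩ := h.exists_two_lt_card_missing hodd hdense
  have hsub : 1 < ((Finset.univ.filter fun v => c ∈ G.missing φ v).filter
      fun v => r v ≠ c).card := by
    have h1 := Finset.card_filter_add_card_filter_not (fun v => r v = c)
      (s := Finset.univ.filter fun v => c ∈ G.missing φ v)
    have h2 : ((Finset.univ.filter fun v => c ∈ G.missing φ v).filter
        fun v => r v = c).card ≤ 1 := by
      rw [Finset.card_le_one]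
      intro a ha b hb
      exact hr ((Finset.mem_filter.1 ha).2.trans (Finset.mem_filter.1 hb).2.symm)
    simp only [ne_eq]
    omega
  obtain ⟨u, hu, v, hv, huv⟩ := Finset.one_lt_card.1 hsub
  simp only [Finset.mem_filter, Finset.mem_univ, true_and] at hu hv
  have hG' := h.addEdge huv hu.1 hv.1
  have hcardE : Fintype.card (G.addEdge u v huv).E = Fintype.card G.E + 1 :=
    Fintype.card_option
  have hcardV : Fintype.card (G.addEdge u v huv).V = Fintype.card G.V := rfl
  have hle := hG'.two_mul_card_le
  rw [hcardE, hcardV] at hle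
  have hmiss' : ∀ x, r x ∈ (G.addEdge u v huv).missing (fun e : Option G.E => e.elim c φ) x := by
    have hnew : ∀ x ∈ s(u, v), c ≠ r x := by
      intro x hx
      rcases Sym2.mem_iff.1 hx with rfl | rfl
      · exact hu.2.symm
      · exact hv.2.symm
    rintro x (_ | e) hx
    · exact hnew x hx
    · exact hmiss x e hx
  obtain ⟨G', hsub', hV, hrest⟩ := ih _ (by rw [hcardE, hcardV]; omega) hG' hodd hr hmiss' rfl
  exact ⟨G', (G.isSubgraph_addEdge u v huv).trans hsub', hV, hrest⟩

theorem maxDegree_add_one_le_of_missing {G : Multigraph} {k : ℕ} {φ : G.E → Fin k}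
    (h : G.IsProperEdgeColoring φ) {r : G.V → Fin k} (hr : ∀ v, r v ∈ G.missing φ v)
    (hk : 0 < k) : G.maxDegree + 1 ≤ k := by
  suffices G.maxDegree ≤ k - 1 by omega
  refine Finset.sup_le fun v _ => ?_
  have : G.degree v ≤ (Finset.univ.erase (r v)).card := by
    refine Finset.card_le_card_of_injOn φ (fun e he => ?_) (fun e he f hf hef => ?_)
    · simpa using hr v e (by simpa using he)
    · by_contra hne
      exact h e f hne ⟨v, by simpa using he, by simpa using hf⟩ hef
  simpa using this

theorem mem_incident {G : Multigraph} {v : G.V} {e : G.E} :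
    e ∈ Finset.univ.filter (fun e => v ∈ G.ends e) ↔ v ∈ G.ends e := by simp

theorem degree_cone_none (G : Multigraph) : G.cone.degree none = Fintype.card G.V := by
  refine (Finset.card_bij (fun v _ => (Sum.inr v : G.E ⊕ G.V)) ?_ ?_ ?_).symm
  · intro v _
    exact (mem_incident (G := G.cone)).2 (Sym2.mem_mk_left _ _)
  · intro a _ b _ hab
    exact Sum.inr_injective hab
  · rintro (e | v) he
    · have hnone : (none : Option G.V) ∉ (G.ends e).map some := by simp
      exact absurd ((mem_incident (G := G.cone)).1 he) hnone
    · exact ⟨v, Finset.mem_univ v, rfl⟩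

theorem degree_cone_some (G : Multigraph) (v : G.V) :
    G.cone.degree (some v) ≤ G.degree v + 1 := by
  have hold : ∀ {e : G.E}, some v ∈ (G.ends e).map some → v ∈ G.ends e := by simp
  have hspoke : ∀ {u : G.V}, some v ∈ s(none, some u) → v = u := by simp
  unfold degree
  rw [← Finset.card_insertNone]
  refine Finset.card_le_card_of_injOn (Sum.elim some fun _ => none) ?_ ?_
  · rintro (e | u) he
    · exact Finset.some_mem_insertNone.2
        (Finset.mem_filter.2 ⟨Finset.mem_univ e, hold ((mem_incident (G := G.cone)).1 he)⟩)
    · exact Finset.none_mem_insertNone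
  · rintro (e | a) he (f | b) hf hef
    · exact congrArg Sum.inl (Option.some_injective _ hef)
    · exact absurd hef (Option.some_ne_none e)
    · exact absurd hef.symm (Option.some_ne_none f)
    · exact congrArg Sum.inr ((hspoke ((mem_incident (G := G.cone)).1 he)).symm.trans
        (hspoke ((mem_incident (G := G.cone)).1 hf)))

theorem maxDegree_cone_le {G : Multigraph} {k : ℕ}
    (hk : max (G.maxDegree + 2) (Fintype.card G.V + 1) ≤ k) : G.cone.maxDegree ≤ k - 1 := by
  refine Finset.sup_le fun v _ => ?_
  rcases v with _ | v
  · rw [degree_cone_none]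
    omega
  · have := G.degree_cone_some v
    have := G.degree_le_maxDegree v
    omega

theorem le_density {G H : Multigraph} (h : IsSubgraph H G) (hodd : Odd (Fintype.card H.V))
    (h3 : 3 ≤ Fintype.card H.V) :
    2 * (Fintype.card H.E : ℝ) / ((Fintype.card H.V : ℝ) - 1) ≤ G.density := by
  refine le_csSup ⟨2 * (Fintype.card G.E : ℝ), ?_⟩ (Or.inr ⟨H, h, hodd, h3, rfl⟩)
  rintro q (rfl | ⟨K, ⟨-, g, -, hg, -⟩, -, hK, rfl⟩)
  · positivity
  · have hK' : (3 : ℝ) ≤ Fintype.card K.V := by exact_mod_cast hK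
    have hE : (Fintype.card K.E : ℝ) ≤ Fintype.card G.E := by
      exact_mod_cast Fintype.card_le_of_injective g hg
    refine (div_le_self (by positivity) (by linarith)).trans (by linarith)

/-- A subgraph of the cone that contains the apex has at most one edge from the apex to each other
vertex. -/
theorem degree_apex_le {G H : Multigraph} {f : H.V → G.cone.V} {g : H.E → G.cone.E}
    (hg : Function.Injective g) (h : ∀ e, G.cone.ends (g e) = (H.ends e).map f) {v : H.V}
    (hv : f v = none) : H.degree v ≤ Fintype.card H.V - 1 := by
  have key : ∀ e, v ∈ H.ends e → ∃ u, H.ends e = s(v, u) ∧ ∃ a, f u = some a ∧ g e = Sum.inr a := by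
    intro e he
    obtain ⟨u, hu⟩ := Sym2.mem_iff_exists.1 he
    have he' := h e
    rw [hu, Sym2.map_mk, hv] at he'
    rcases hge : g e with e' | a
    · rw [hge] at he'
      have : (none : Option G.V) ∈ (G.ends e').map some := by
        change (G.ends e').map some = _ at he'
        rw [he']
        exact Sym2.mem_mk_left _ _
      simp at this
    · rw [hge] at he'
      exact ⟨u, hu, a, (Sym2.congr_right.1 he').symm, rfl⟩
  have : Nonempty H.V := ⟨v⟩
  choose! u hu key using key
  have hle : H.degree v ≤ (Finset.univ.erase v).card := by
    refine Finset.card_le_card_of_injOn u (fun e he => ?_) (fun e he e' he' hee' => ?_)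
    · have he : v ∈ H.ends e := by simpa using he
      have := H.loopless e
      rw [hu e he, Sym2.mk_isDiag_iff] at this
      simpa using Ne.symm this
    · have he : v ∈ H.ends e := by simpa using he
      have he' : v ∈ H.ends e' := by simpa using he'
      apply hg
      obtain ⟨a, hfa, hga⟩ := key e he
      obtain ⟨b, hfb, hgb⟩ := key e' he'
      rw [hee', hfb] at hfa
      rw [hga, hgb, Option.some_injective _ hfa]
  rwa [Finset.card_erase_of_mem (Finset.mem_univ v), Finset.card_univ] at hle

theorem isSubgraph_of_isSubgraph_cone {G H : Multigraph} {f : H.V → G.cone.V}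
    {g : H.E → G.cone.E} (hf : Function.Injective f) (hg : Function.Injective g)
    (h : ∀ e, G.cone.ends (g e) = (H.ends e).map f) (hv : ∀ v, f v ≠ none) :
    IsSubgraph H G := by
  have hf' : ∀ v, ∃ u : G.V, f v = some u := fun v => Option.ne_none_iff_exists'.1 (hv v)
  choose f' hf' using hf'
  have hff : f = some ∘ f' := funext hf'
  have hg' : ∀ e, ∃ e' : G.E, g e = Sum.inl e' := by
    intro e
    rcases hge : g e with e' | a
    · exact ⟨e', rfl⟩
    · have he := h e
      rw [hge] at he
      have : (none : Option G.V) ∈ (H.ends e).map f := by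
        rw [← he]
        exact Sym2.mem_mk_left _ _
      obtain ⟨v, -, hv'⟩ := Sym2.mem_map.1 this
      exact absurd hv' (hv v)
  choose g' hg' using hg'
  refine ⟨f', g', ?_, ?_, fun e => ?_⟩
  · intro a b hab
    exact hf (by rw [hf', hf', hab])
  · intro a b hab
    exact hg (by rw [hg', hg', hab])
  · have he := h e
    rw [hg', hff] at he
    exact Sym2.map.injective (Option.some_injective _) (he.trans (Sym2.map_map _).symm)

theorem density_cone_le {G : Multigraph} {k : ℕ}
    (hk : max (G.maxDegree + 2) (Fintype.card G.V + 1) ≤ k) (hG : G.density ≤ k) :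
    G.cone.density ≤ k := by
  refine csSup_le ⟨0, Or.inl rfl⟩ ?_
  rintro q (rfl | ⟨H, ⟨f, g, hf, hg, h⟩, hodd, h3, rfl⟩)
  · positivity
  by_cases hv : ∀ v, f v ≠ none
  · exact (le_density (isSubgraph_of_isSubgraph_cone hf hg h hv) hodd h3).trans hG
  push Not at hv
  obtain ⟨v, hv⟩ := hv
  have hdeg : ∀ u, H.degree u ≤ k - 1 := fun u =>
    (degree_le_of_isSubgraph hg h u).trans
      ((G.cone.degree_le_maxDegree _).trans (maxDegree_cone_le hk))
  have hsum : ∑ u ∈ Finset.univ.erase v, H.degree u ≤ (Fintype.card H.V - 1) * (k - 1) := by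
    refine (Finset.sum_le_card_nsmul _ _ _ fun u _ => hdeg u).trans ?_
    simp
  have hapex := degree_apex_le hg h hv
  have hE := H.sum_degree
  rw [← Finset.add_sum_erase _ _ (Finset.mem_univ v)] at hE
  obtain ⟨m, hm⟩ : ∃ m, Fintype.card H.V = m + 1 := ⟨Fintype.card H.V - 1, by omega⟩
  obtain ⟨j, rfl⟩ : ∃ j, k = j + 1 := ⟨k - 1, by omega⟩
  rw [hm] at hsum hapex h3
  simp only [Nat.add_sub_cancel] at hsum hapex
  have hfin : 2 * Fintype.card H.E ≤ (j + 1) * m := by linarith [mul_comm m j]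
  have hm0 : (0 : ℝ) < m := by exact_mod_cast (by omega : 0 < m)
  rw [hm, div_le_iff₀ (by push_cast; linarith)]
  have : (2 * (Fintype.card H.E : ℝ)) ≤ ((j : ℝ) + 1) * m := by exact_mod_cast hfin
  push_cast
  linarith

theorem exists_coloring_of_cone {G : Multigraph} {k : ℕ} {ψ : G.cone.E → Fin k}
    (h : G.cone.IsProperEdgeColoring ψ) :
    ∃ (φ : G.E → Fin k) (r : G.V → Fin k), G.IsProperEdgeColoring φ ∧
      Function.Injective r ∧ ∀ v, r v ∈ G.missing φ v := by
  have hmem : ∀ {v e}, v ∈ G.ends e → (some v : G.cone.V) ∈ G.cone.ends (Sum.inl e) :=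
    fun hv => Sym2.mem_map.2 ⟨_, hv, rfl⟩
  refine ⟨fun e => ψ (Sum.inl e), fun v => ψ (Sum.inr v), ?_, ?_, ?_⟩
  · rintro e f hne ⟨v, hv, hv'⟩
    exact h _ _ (Sum.inl_injective.ne hne) ⟨some v, hmem hv, hmem hv'⟩
  · intro a b hab
    by_contra hne
    exact h _ _ (Sum.inr_injective.ne hne)
      ⟨none, Sym2.mem_mk_left _ _, Sym2.mem_mk_left _ _⟩ hab
  · intro v e hv
    exact h _ _ Sum.inl_ne_inr ⟨some v, hmem hv, Sym2.mem_mk_right _ _⟩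

/-- Up to adding an isolated vertex, a coloring with distinct missing representatives lives on a
graph of odd order. -/
theorem IsProperEdgeColoring.exists_odd_extension {G : Multigraph} {k : ℕ} {φ : G.E → Fin k}
    (h : G.IsProperEdgeColoring φ) (hk : Fintype.card G.V < k) {r : G.V → Fin k}
    (hr : Function.Injective r) (hmiss : ∀ v, r v ∈ G.missing φ v) :
    ∃ G' : Multigraph, IsSubgraph G G' ∧ Odd (Fintype.card G'.V) ∧
      ∃ (φ' : G'.E → Fin k) (r' : G'.V → Fin k), G'.IsProperEdgeColoring φ' ∧
        Function.Injective r' ∧ ∀ v, r' v ∈ G'.missing φ' v := by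
  rcases Nat.even_or_odd (Fintype.card G.V) with heven | hodd
  swap
  · exact ⟨G, .refl G, hodd, φ, r, h, hr, hmiss⟩
  obtain ⟨c, hc⟩ : ∃ c, c ∉ Set.range r := by
    by_contra! hall
    have := Fintype.card_le_of_surjective r hall
    rw [Fintype.card_fin] at this
    omega
  have hnone : ∀ e : G.E, (none : Option G.V) ∉ (G.ends e).map some := by simp
  have hsome : ∀ {e : G.E} {v : G.V}, some v ∈ (G.ends e).map some → v ∈ G.ends e := by simp
  refine ⟨G.addVertex, G.isSubgraph_addVertex, ?_, φ, fun v : Option G.V => v.elim c r,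
    ?_, ?_, ?_⟩
  · have : Fintype.card G.addVertex.V = Fintype.card G.V + 1 := Fintype.card_option
    rw [this]
    exact heven.add_one
  · rintro e f hne ⟨_ | v, hv, hv'⟩
    · exact absurd hv (hnone e)
    · exact h e f hne ⟨v, hsome hv, hsome hv'⟩
  · rintro (_ | a) (_ | b) hab
    · rfl
    · exact absurd ⟨b, hab.symm⟩ hc
    · exact absurd ⟨a, hab⟩ hc
    · exact congrArg some (hr hab)
  · rintro (_ | v) e hv
    · exact absurd hv (hnone e)
    · exact hmiss v e (hsome hv)

theorem two_le_card_of_chromaticIndex_pos {G : Multigraph} (h : 0 < G.chromaticIndex) :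
    2 ≤ Fintype.card G.V := by
  by_contra! hlt
  have : IsEmpty G.E := by
    refine ⟨fun e => ?_⟩
    have := (G.card_ends e).symm.trans_le (Finset.card_le_univ _)
    omega
  have : G.chromaticIndex ≤ 0 :=
    IsProperEdgeColoring.chromaticIndex_le (φ := fun e => isEmptyElim e) fun e => isEmptyElim e
  omega

end Multigraph

/-- Assuming the Goldberg–Seymour statement, every multigraph `G`
with χ'(G) = k ≥ max{Δ(G)+2, |V(G)|+1} is a subgraph of a `k`-dense multigraph
`G'` with χ'(G') = k and Δ(G') ≤ k−1. -/
theorem embeds_in_dense_graph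
    (GS : ∀ H : Multigraph, H.maxDegree + 2 ≤ H.chromaticIndex →
      H.chromaticIndex = ⌈H.density⌉₊)
    (G : Multigraph) (k : ℕ) (hchi : G.chromaticIndex = k)
    (hk : max (G.maxDegree + 2) (Fintype.card G.V + 1) ≤ k) :
    ∃ G' : Multigraph, IsSubgraph G G' ∧ Odd (Fintype.card G'.V) ∧
      3 ≤ Fintype.card G'.V ∧
      2 * Fintype.card G'.E = k * (Fintype.card G'.V - 1) ∧
      G'.chromaticIndex = k ∧ (G'.maxDegree : ℤ) ≤ (k : ℤ) - 1 := by
  have hGd : G.density ≤ k := by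
    rw [← hchi, GS G (by omega)]
    exact Nat.le_ceil _
  have hcone : G.cone.chromaticIndex ≤ k := by
    by_contra! hlt
    have := maxDegree_cone_le hk
    rw [GS G.cone (by omega)] at hlt
    exact absurd (Nat.ceil_le.2 (density_cone_le hk hGd)) (by omega)
  obtain ⟨ψ, hψ⟩ := exists_isProperEdgeColoring_of_le hcone
  obtain ⟨φ, r, hφ, hr, hmiss⟩ := exists_coloring_of_cone hψ
  obtain ⟨G₁, hsub₁, hodd, φ₁, r₁, hφ₁, hr₁, hmiss₁⟩ :=
    hφ.exists_odd_extension (by omega) hr hmiss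
  obtain ⟨G₂, hsub₂, hV, hE, φ₂, r₂, hφ₂, hmiss₂⟩ := hφ₁.exists_dense_extension hodd hr₁ hmiss₁
  have hsub := hsub₁.trans hsub₂
  have hchi₂ : G₂.chromaticIndex = k :=
    le_antisymm hφ₂.chromaticIndex_le (hchi ▸ hsub.chromaticIndex_le)
  have hdeg := maxDegree_add_one_le_of_missing hφ₂ hmiss₂ (by omega)
  have hcard : 2 ≤ Fintype.card G₂.V := two_le_card_of_chromaticIndex_pos (by omega)
  rw [← hV] at hodd
  obtain ⟨m, hm⟩ := hodd
  exact ⟨G₂, hsub, ⟨m, hm⟩, by omega, hE, hchi₂, by omega⟩
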